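/- Every positive real zero of a Hankel determinant is simple: there is no n ≥ 1 and no ω* > 0 such that h_n(ω*) = 0 and h_n'(ω*) = 0, where the prime denotes the derivative with respect to ω. -/

import Mathlib

open MeasureTheory

/-- Moments of the oscillatory weight `e^{iωx}` on `[-1,1]`. -/
noncomputable def mu (ω : ℝ) (n : ℕ) : ℂ :=
  ∫ x : ℝ in (-1 : ℝ)..1, (x : ℂ) ^ n * Complex.exp (Complex.I * ω * x)

/-- The `(n+1) × (n+1)` Hankel determinant of the moments. -/
noncomputable def hankel (n : ℕ) (ω : ℝ) : ℂ :=
  Matrix.det (Matrix.of fun j k : Fin (n + 1) => mu ω ((j : ℕ) + (k : ℕ)))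

open scoped ComplexConjugate Polynomial

/-- The space of smooth complex-valued functions on the real line. -/
def smoothSubmodule : Submodule ℂ (ℝ → ℂ) where
  carrier := {w | ContDiff ℝ (⊤ : ℕ∞) w}
  add_mem' {u v} (hu : ContDiff ℝ (⊤ : ℕ∞) u) (hv : ContDiff ℝ (⊤ : ℕ∞) v) := hu.add hv
  zero_mem' := show ContDiff ℝ (⊤ : ℕ∞) fun _ : ℝ => (0 : ℂ) from contDiff_const
  smul_mem' c w (hw : ContDiff ℝ (⊤ : ℕ∞) w) := hw.const_smul c

/-- Smooth complex-valued functions on the real line. -/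
abbrev SmoothFun : Type := smoothSubmodule

namespace SmoothFun

lemma contDiff (w : SmoothFun) : ContDiff ℝ (⊤ : ℕ∞) (w : ℝ → ℂ) := w.2

lemma differentiable (w : SmoothFun) : Differentiable ℝ (w : ℝ → ℂ) :=
  w.contDiff.differentiable (by simp)

lemma continuous (w : SmoothFun) : Continuous (w : ℝ → ℂ) := w.contDiff.continuous

/-- Differentiation as an endomorphism of the smooth functions. -/
noncomputable def derivEnd : Module.End ℂ SmoothFun where
  toFun w := ⟨deriv w, (contDiff_infty_iff_deriv.mp w.2).2⟩
  map_add' u v := by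
    ext x
    exact deriv_add (u.differentiable x) (v.differentiable x)
  map_smul' c u := by
    ext x
    exact deriv_const_smul c (u.differentiable x)

/-- The twisted derivative `w ↦ w' + i c w`. -/
noncomputable def twist (c : ℝ) : Module.End ℂ SmoothFun :=
  derivEnd + (Complex.I * c) • 1

lemma twist_apply (c : ℝ) (w : SmoothFun) (x : ℝ) :
    (twist c w : ℝ → ℂ) x = deriv w x + Complex.I * c * (w : ℝ → ℂ) x := rfl

lemma twist_zero : twist 0 = derivEnd := by
  simp [twist]

lemma twist_zero_eq_sub (c : ℝ) : twist 0 = twist c - (Complex.I * c) • 1 := by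
  rw [twist_zero]
  exact (add_sub_cancel_right derivEnd ((Complex.I * c) • (1 : Module.End ℂ SmoothFun))).symm

lemma commute_twist (a b : ℝ) : Commute (twist a) (twist b) := by
  unfold twist
  refine Commute.add_left (Commute.add_right rfl ?_) (Commute.add_right ?_ ?_)
  · exact (Commute.one_right _).smul_right _
  · exact (Commute.one_left _).smul_left _
  · exact (Commute.one_left _).smul_left _

lemma hasDerivAt_twist_sub (c : ℝ) (w : SmoothFun) (x : ℝ) :
    HasDerivAt (w : ℝ → ℂ) ((twist c w : ℝ → ℂ) x - Complex.I * c * (w : ℝ → ℂ) x) x := by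
  simpa [twist_apply] using (w.differentiable x).hasDerivAt

/-- Vanishing at both end points of `[-1, 1]`. -/
def VanishesAtEnds (w : SmoothFun) : Prop := (w : ℝ → ℂ) (-1) = 0 ∧ (w : ℝ → ℂ) 1 = 0

/-- The sesquilinear `L²` pairing on `[-1, 1]`. -/
noncomputable def pairing (u v : SmoothFun) : ℂ :=
  ∫ x : ℝ in (-1 : ℝ)..1, (u : ℝ → ℂ) x * conj ((v : ℝ → ℂ) x)

lemma conj_pairing (u v : SmoothFun) : conj (pairing u v) = pairing v u := by
  unfold pairing
  simp only [intervalIntegral, map_sub, ← integral_conj, map_mul, Complex.conj_conj, mul_comm]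

lemma pairing_twist (c : ℝ) (u v : SmoothFun) (hu : VanishesAtEnds u) :
    pairing (twist c u) v = -pairing u (twist c v) := by
  have hv : ∀ x, HasDerivAt (fun y => conj ((v : ℝ → ℂ) y)) (conj (deriv v x)) x := fun x =>
    (v.differentiable x).hasDerivAt.star
  have key : ∫ x : ℝ in (-1 : ℝ)..1,
      (deriv u x * conj ((v : ℝ → ℂ) x) + (u : ℝ → ℂ) x * conj (deriv v x)) = 0 := by
    rw [intervalIntegral.integral_deriv_mul_eq_sub
      (fun x _ => (u.differentiable x).hasDerivAt) (fun x _ => hv x)]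
    · simp [hu.1, hu.2]
    · exact (derivEnd u).continuous.intervalIntegrable _ _
    · exact (Complex.continuous_conj.comp (derivEnd v).continuous).intervalIntegrable _ _
  have hcont : ∀ a b : SmoothFun,
      IntervalIntegrable (fun x => (a : ℝ → ℂ) x * conj ((b : ℝ → ℂ) x)) volume (-1) 1 := fun a b =>
    (a.continuous.mul (Complex.continuous_conj.comp b.continuous)).intervalIntegrable _ _
  rw [eq_neg_iff_add_eq_zero, pairing, pairing, ← intervalIntegral.integral_add (hcont _ _)
    (hcont _ _), ← key]
  congr 1
  ext x
  simp only [twist_apply, map_add, map_mul, Complex.conj_I, Complex.conj_ofReal]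
  ring

lemma pairing_twist_pow (c : ℝ) (k : ℕ) (u v : SmoothFun)
    (hu : ∀ j < k, VanishesAtEnds ((twist c ^ j) u)) :
    pairing ((twist c ^ k) u) v = (-1) ^ k * pairing u ((twist c ^ k) v) := by
  induction k generalizing v with
  | zero => simp
  | succ k ih =>
    rw [pow_succ', Module.End.mul_apply, pairing_twist _ _ _ (hu k k.lt_succ_self),
      ih _ (fun j hj => hu j (hj.trans k.lt_succ_self)), ← Module.End.mul_apply, ← pow_succ,
      ← pow_succ']
    ring

lemma VanishesAtEnds.sub_smul {u v : SmoothFun} (hu : VanishesAtEnds u) (hv : VanishesAtEnds v)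
    (c : ℂ) : VanishesAtEnds (u - c • v) := by
  constructor
  · simp [hu.1, hv.1]
  · simp [hu.2, hv.2]

/-- If the first `m` twisted derivatives vanish at the end points, so do all mixed ones. -/
lemma vanishesAtEnds_mixed {c : ℝ} {m : ℕ} {w : SmoothFun}
    (hw : ∀ j < m, VanishesAtEnds ((twist c ^ j) w)) (k j : ℕ) (hjk : j + k < m) :
    VanishesAtEnds ((twist c ^ j) ((twist 0 ^ k) w)) := by
  induction k generalizing j with
  | zero => simpa using hw j hjk
  | succ k ih =>
    have h : (twist c ^ j) ((twist 0 ^ (k + 1)) w) = (twist c ^ (j + 1)) ((twist 0 ^ k) w)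
        - (Complex.I * c) • (twist c ^ j) ((twist 0 ^ k) w) := by
      rw [pow_succ' (twist 0), Module.End.mul_apply]
      nth_rewrite 1 [twist_zero_eq_sub c]
      rw [LinearMap.sub_apply, map_sub, LinearMap.smul_apply, map_smul, pow_succ,
        Module.End.mul_apply, Module.End.one_apply]
    rw [h]
    exact (ih _ (by omega)).sub_smul (ih _ (by omega)) _

/-- The function `x ↦ e^{iωx}`. -/
noncomputable def expWeight (ω x : ℝ) : ℂ := Complex.exp (Complex.I * ω * x)

lemma contDiff_expWeight (ω : ℝ) : ContDiff ℝ (⊤ : ℕ∞) (expWeight ω) := by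
  unfold expWeight
  exact (contDiff_const.mul Complex.ofRealCLM.contDiff).cexp

lemma hasDerivAt_expWeight (ω x : ℝ) :
    HasDerivAt (expWeight ω) (Complex.I * ω * expWeight ω x) x := by
  have h : HasDerivAt (fun y : ℝ => Complex.I * ω * (y : ℂ)) (Complex.I * ω) x := by
    simpa using (Complex.ofRealCLM.hasDerivAt (x := x)).const_mul (Complex.I * ω)
  exact h.cexp.congr_deriv (mul_comm _ _)

lemma expWeight_neg_mul (ω x : ℝ) : expWeight (-ω) x * expWeight ω x = 1 := by
  simp [expWeight, ← Complex.exp_add]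

lemma expWeight_ne_zero (ω x : ℝ) : expWeight ω x ≠ 0 := Complex.exp_ne_zero _

/-- The moments of a function against the oscillatory weight. -/
noncomputable def moment (ω : ℝ) (w : SmoothFun) (j : ℕ) : ℂ :=
  ∫ x : ℝ in (-1 : ℝ)..1, (x : ℂ) ^ j * (expWeight ω x * (w : ℝ → ℂ) x)

lemma hasDerivAt_expWeight_mul (ω : ℝ) (w : SmoothFun) (x : ℝ) :
    HasDerivAt (fun y => expWeight ω y * (w : ℝ → ℂ) y)
      (expWeight ω x * (twist ω w : ℝ → ℂ) x) x := by
  refine ((hasDerivAt_expWeight ω x).mul (w.differentiable x).hasDerivAt).congr_deriv ?_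
  rw [twist_apply]
  ring

lemma exists_twist_eq (ω : ℝ) (u : SmoothFun) :
    ∃ v : SmoothFun, twist ω v = u ∧ (v : ℝ → ℂ) (-1) = 0 := by
  have hu : ContDiff ℝ (⊤ : ℕ∞) fun x => expWeight ω x * (u : ℝ → ℂ) x :=
    (contDiff_expWeight ω).mul u.contDiff
  set F : ℝ → ℂ := fun x => ∫ s in (-1 : ℝ)..x, expWeight ω s * (u : ℝ → ℂ) s with hF
  have hF' : ∀ x, HasDerivAt F (expWeight ω x * (u : ℝ → ℂ) x) x := fun x =>
    hu.continuous.integral_hasStrictDerivAt _ x |>.hasDerivAt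
  have hFs : ContDiff ℝ (⊤ : ℕ∞) F := by
    rw [contDiff_infty_iff_deriv]
    refine ⟨fun x => (hF' x).differentiableAt, ?_⟩
    rwa [funext fun x => (hF' x).deriv]
  refine ⟨⟨fun x => expWeight (-ω) x * F x, (contDiff_expWeight _).mul hFs⟩, ?_, ?_⟩
  · ext x
    rw [twist_apply]
    have h := ((hasDerivAt_expWeight (-ω) x).mul (hF' x)).deriv
    simp only [Pi.mul_def] at h
    simp only [h]
    linear_combination (expWeight_neg_mul ω x) * (u : ℝ → ℂ) x
      + (Complex.I * expWeight (-ω) x * F x) * (Complex.ofReal_neg ω)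
  · simp [hF]

lemma moment_twist_succ (ω : ℝ) (v : SmoothFun) (hv : VanishesAtEnds v)
    (j : ℕ) : moment ω (twist ω v) (j + 1) = -((j + 1) * moment ω v j) := by
  have hp : ∀ x : ℝ, HasDerivAt (fun y : ℝ => (y : ℂ) ^ (j + 1)) ((j + 1) * (x : ℂ) ^ j) x := by
    intro x
    simpa using (hasDerivAt_pow (j + 1) (x : ℂ)).comp_ofReal
  have hpow : ∀ k : ℕ, Continuous fun x : ℝ => (x : ℂ) ^ k := fun k =>
    Complex.continuous_ofReal.pow k
  rw [moment, intervalIntegral.integral_mul_deriv_eq_deriv_mul (fun x _ => hp x)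
    (fun x _ => hasDerivAt_expWeight_mul ω v x)]
  · rw [hv.1, hv.2, moment, ← intervalIntegral.integral_const_mul]
    simp [mul_assoc]
  · exact (continuous_const.mul (hpow j)).intervalIntegrable _ _
  · exact ((contDiff_expWeight ω).continuous.mul (twist ω v).continuous).intervalIntegrable _ _

/-- A function with `m` vanishing oscillatory moments is the `m`-th twisted derivative of a function
vanishing at the end points to order `m`. -/
lemma exists_twist_pow_eq (ω : ℝ) (m : ℕ) (u : SmoothFun) (hu : ∀ j < m, moment ω u j = 0) :
    ∃ w : SmoothFun, (twist ω ^ m) w = u ∧ ∀ j < m, VanishesAtEnds ((twist ω ^ j) w) := by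
  induction m generalizing u with
  | zero => exact ⟨u, by simp⟩
  | succ m ih =>
    obtain ⟨v, rfl, hv0⟩ := exists_twist_eq ω u
    have hv : VanishesAtEnds v := by
      refine ⟨hv0, ?_⟩
      have h := hu 0 m.succ_pos
      simp only [moment, pow_zero, one_mul] at h
      rw [intervalIntegral.integral_eq_sub_of_hasDerivAt
        (fun x _ => hasDerivAt_expWeight_mul ω v x)
        (((contDiff_expWeight ω).continuous.mul (twist ω v).continuous).intervalIntegrable _ _),
        hv0, mul_zero, sub_zero] at h
      exact (mul_eq_zero.mp h).resolve_left (expWeight_ne_zero ω 1)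
    obtain ⟨w, rfl, hw⟩ := ih v fun j hj => by
      have h := hu (j + 1) (by omega)
      rw [moment_twist_succ ω v hv, neg_eq_zero] at h
      exact (mul_eq_zero.mp h).resolve_left (by exact_mod_cast j.succ_ne_zero)
    refine ⟨w, by rw [pow_succ', Module.End.mul_apply], fun j hj => ?_⟩
    rcases Nat.lt_succ_iff_lt_or_eq.mp hj with h | rfl
    · exact hw j h
    · exact hv

lemma eqOn_zero_of_twist_zero_pow (k : ℕ) (u : SmoothFun)
    (hu : ∀ j < k, VanishesAtEnds ((twist 0 ^ j) u))
    (h : Set.EqOn ((twist 0 ^ k) u : ℝ → ℂ) 0 (Set.Ioo (-1) 1)) :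
    Set.EqOn (u : ℝ → ℂ) 0 (Set.Ioo (-1) 1) := by
  induction k with
  | zero => simpa using h
  | succ k ih =>
    refine ih (fun j hj => hu j (by omega)) fun x hx => ?_
    rw [pow_succ', Module.End.mul_apply] at h
    set v := (twist 0 ^ k) u
    have hd : ∀ y, HasDerivAt (v : ℝ → ℂ) ((twist 0 v : ℝ → ℂ) y) y := fun y => by
      simpa using hasDerivAt_twist_sub 0 v y
    have := constant_of_has_deriv_right_zero (f := (v : ℝ → ℂ)) (a := -1) (b := x)
      v.continuous.continuousOn (fun y hy => by
        have h0 : (twist 0 v : ℝ → ℂ) y = 0 := by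
          have hcl : Set.EqOn (twist 0 v : ℝ → ℂ) 0 (closure (Set.Ioo (-1) 1)) :=
            h.closure (twist 0 v).continuous continuous_const
          rw [closure_Ioo (by norm_num)] at hcl
          exact hcl ⟨hy.1, hy.2.le.trans hx.2.le⟩
        rw [← h0]
        exact (hd y).hasDerivWithinAt) x ⟨hx.1.le, le_rfl⟩
    rw [this, (hu k k.lt_succ_self).1]
    rfl

lemma twist_pow_eqOn_zero (c : ℝ) (k : ℕ) (u : SmoothFun)
    (h : Set.EqOn (u : ℝ → ℂ) 0 (Set.Ioo (-1) 1)) :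
    Set.EqOn ((twist c ^ k) u : ℝ → ℂ) 0 (Set.Ioo (-1) 1) := by
  induction k with
  | zero => simpa using h
  | succ k ih =>
    intro x hx
    rw [pow_succ', Module.End.mul_apply, twist_apply, ih hx,
      (ih.eventuallyEq_of_mem (isOpen_Ioo.mem_nhds hx)).deriv_eq]
    simp

lemma eqOn_zero_of_pairing_self (u : SmoothFun) (h : pairing u u = 0) :
    Set.EqOn (u : ℝ → ℂ) 0 (Set.Ioo (-1) 1) := by
  have h1 : ∫ x : ℝ in (-1 : ℝ)..1, Complex.normSq ((u : ℝ → ℂ) x) = 0 := by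
    have : pairing u u = ((∫ x : ℝ in (-1 : ℝ)..1, Complex.normSq ((u : ℝ → ℂ) x) : ℝ) : ℂ) := by
      rw [pairing, ← intervalIntegral.integral_ofReal]
      simp [Complex.mul_conj]
    rw [this] at h
    exact_mod_cast h
  intro x hx
  by_contra hne
  have hc : Continuous fun x => Complex.normSq ((u : ℝ → ℂ) x) :=
    Complex.continuous_normSq.comp u.continuous
  refine h1.not_gt (intervalIntegral.integral_pos (by norm_num) hc.continuousOn
    (fun y _ => Complex.normSq_nonneg _) ⟨x, Set.Ioo_subset_Icc_self hx, ?_⟩)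
  exact Complex.normSq_pos.mpr hne

/-- A polynomial regarded as a smooth function. -/
noncomputable def ofPolynomial (p : ℂ[X]) : SmoothFun :=
  ⟨fun x => p.eval (x : ℂ), by
    have h := ((p.contDiff_aeval (𝕜 := ℂ) (⊤ : ℕ∞)).restrict_scalars ℝ).comp
      Complex.ofRealCLM.contDiff
    simp only [Polynomial.coe_aeval_eq_eval] at h
    exact h⟩

lemma twist_zero_ofPolynomial (p : ℂ[X]) :
    twist 0 (ofPolynomial p) = ofPolynomial (Polynomial.derivative p) := by
  ext x
  have h := ((p.hasDerivAt (x : ℂ)).comp_ofReal).deriv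
  simpa [twist_apply, ofPolynomial] using h

lemma twist_zero_pow_ofPolynomial (p : ℂ[X]) (k : ℕ) :
    (twist 0 ^ k) (ofPolynomial p) = ofPolynomial (Polynomial.derivative^[k] p) := by
  induction k with
  | zero => simp
  | succ k ih =>
    rw [pow_succ', Module.End.mul_apply, ih, twist_zero_ofPolynomial, Function.iterate_succ_apply']

lemma ofPolynomial_zero : ofPolynomial 0 = 0 := by
  ext x
  simp [ofPolynomial]

lemma eq_zero_of_ofPolynomial_eqOn (p : ℂ[X])
    (h : Set.EqOn (ofPolynomial p : ℝ → ℂ) 0 (Set.Ioo (-1) 1)) : p = 0 := by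
  refine Polynomial.eq_zero_of_infinite_isRoot p
    (((Set.Ioo_infinite (by norm_num : (-1 : ℝ) < 1)).image
      Complex.ofReal_injective.injOn).mono ?_)
  rintro _ ⟨x, hx, rfl⟩
  exact h hx

/-- A polynomial of degree less than `2N` with `2N` vanishing oscillatory moments is zero. -/
theorem polynomial_eq_zero_of_moment_eq_zero (ω : ℝ) (N : ℕ) (p : ℂ[X])
    (hdeg : p.degree < (2 * N : ℕ)) (hp : ∀ j < 2 * N, moment ω (ofPolynomial p) j = 0) :
    p = 0 := by
  obtain ⟨w, hw, hv⟩ := exists_twist_pow_eq ω (2 * N) _ hp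
  have hcomm : ∀ i j : ℕ, ∀ f : SmoothFun,
      (twist 0 ^ i) ((twist ω ^ j) f) = (twist ω ^ j) ((twist 0 ^ i) f) := fun i j f =>
    LinearMap.congr_fun ((commute_twist 0 ω).pow_pow i j).eq f
  have hmix := vanishesAtEnds_mixed hv
  have hsplit : ∀ (c : ℝ) (f : SmoothFun),
      (twist c ^ (2 * N)) f = (twist c ^ N) ((twist c ^ N) f) := fun c f => by
    rw [two_mul, pow_add, Module.End.mul_apply]
  have hsign : (-1 : ℂ) ^ N * (-1) ^ N = 1 := by
    rw [← mul_pow]; simp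
  have horth : pairing (ofPolynomial p) ((twist 0 ^ (2 * N)) w) = 0 := by
    rw [← conj_pairing, pairing_twist_pow 0 _ _ _ (fun j hj => by simpa using hmix j 0 (by omega)),
      twist_zero_pow_ofPolynomial, Polynomial.iterate_derivative_eq_zero_of_degree_lt hdeg,
      ofPolynomial_zero]
    simp [pairing]
  have hself : pairing ((twist 0 ^ N) ((twist ω ^ N) w)) ((twist 0 ^ N) ((twist ω ^ N) w)) = 0 := by
    have h2 := pairing_twist_pow 0 N ((twist ω ^ N) w) ((twist 0 ^ N) ((twist ω ^ N) w))
      (fun j hj => by rw [hcomm]; exact hmix _ _ (by omega))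
    have h1 := pairing_twist_pow ω N ((twist ω ^ N) w) ((twist 0 ^ (2 * N)) w)
      (fun j hj => by
        rw [← Module.End.mul_apply, ← pow_add]
        exact hv _ (by omega))
    rw [← hsplit ω, hw, horth, ← hcomm, hsplit 0] at h1
    rw [h2, ← h1]
  have hzero : Set.EqOn ((twist ω ^ N) w : ℝ → ℂ) 0 (Set.Ioo (-1) 1) :=
    eqOn_zero_of_twist_zero_pow N _ (fun j hj => by rw [hcomm]; exact hmix _ _ (by omega))
      (eqOn_zero_of_pairing_self _ hself)
  refine eq_zero_of_ofPolynomial_eqOn p ?_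
  rw [← hw, hsplit]
  exact twist_pow_eqOn_zero ω N _ hzero

end SmoothFun

open SmoothFun

/-- The `m × m` Hankel matrix of the moments. -/
noncomputable def hankelMatrix (m : ℕ) (ω : ℝ) : Matrix (Fin m) (Fin m) ℂ :=
  Matrix.of fun j k => mu ω ((j : ℕ) + (k : ℕ))

/-- The polynomial of degree less than `m` with given coefficients. -/
noncomputable def polyOfCoeffs {m : ℕ} (v : Fin m → ℂ) : ℂ[X] :=
  ∑ k : Fin m, Polynomial.monomial (k : ℕ) (v k)

lemma degree_polyOfCoeffs_lt {m : ℕ} (v : Fin m → ℂ) : (polyOfCoeffs v).degree < m := by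
  refine Polynomial.degree_lt_iff_coeff_zero _ _ |>.mpr fun j hj => ?_
  rw [polyOfCoeffs, Polynomial.finsetSum_coeff]
  refine Finset.sum_eq_zero fun k _ => Polynomial.coeff_monomial_of_ne _ ?_
  have := k.isLt
  omega

lemma coeff_polyOfCoeffs {m : ℕ} (v : Fin m → ℂ) (k : Fin m) :
    (polyOfCoeffs v).coeff k = v k := by
  simp [polyOfCoeffs, Polynomial.coeff_monomial, Fin.val_inj]

lemma polyOfCoeffs_eq_zero {m : ℕ} {v : Fin m → ℂ} (h : polyOfCoeffs v = 0) : v = 0 := by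
  ext k
  rw [← coeff_polyOfCoeffs v k, h]
  simp

lemma moment_polyOfCoeffs (ω : ℝ) {m : ℕ} (v : Fin m → ℂ) (j : ℕ) :
    moment ω (ofPolynomial (polyOfCoeffs v)) j = ∑ k : Fin m, mu ω (j + k) * v k := by
  simp only [moment, mu, ← intervalIntegral.integral_mul_const]
  rw [← intervalIntegral.integral_finsetSum]
  · congr 1
    ext x
    simp only [ofPolynomial, polyOfCoeffs, Polynomial.eval_finsetSum, Polynomial.eval_monomial,
      Finset.mul_sum, expWeight]
    refine Finset.sum_congr rfl fun k _ => ?_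
    ring
  · intro k _
    exact Continuous.intervalIntegrable (by fun_prop) _ _

lemma hankelMatrix_mulVec (m : ℕ) (ω : ℝ) (v : Fin m → ℂ) (j : Fin m) :
    (hankelMatrix m ω).mulVec v j = moment ω (ofPolynomial (polyOfCoeffs v)) j := by
  rw [moment_polyOfCoeffs]
  rfl

/-- The Hankel determinants of even size have no real zeros. -/
theorem det_hankelMatrix_two_mul_ne_zero (N : ℕ) (ω : ℝ) : (hankelMatrix (2 * N) ω).det ≠ 0 := by
  intro h
  obtain ⟨v, hv, hHv⟩ := Matrix.exists_mulVec_eq_zero_iff.mpr h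
  refine hv (polyOfCoeffs_eq_zero (polynomial_eq_zero_of_moment_eq_zero ω N _
    (degree_polyOfCoeffs_lt v) fun j hj => ?_))
  rw [← hankelMatrix_mulVec (2 * N) ω v ⟨j, hj⟩, hHv]
  rfl

lemma hasDerivAt_mu (n : ℕ) (ω : ℝ) :
    HasDerivAt (fun ω => mu ω n) (Complex.I * mu ω (n + 1)) ω := by
  have h := (intervalIntegral.hasDerivAt_integral_of_dominated_loc_of_deriv_le (𝕜 := ℝ)
    (μ := volume) (a := -1) (b := 1) (x₀ := ω) (s := Set.univ) (bound := fun _ => 1)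
    (F := fun ω x => (x : ℂ) ^ n * Complex.exp (Complex.I * ω * x))
    (F' := fun ω x => Complex.I * ((x : ℂ) ^ (n + 1) * Complex.exp (Complex.I * ω * x)))
    Filter.univ_mem
    (Filter.Eventually.of_forall fun _ => Continuous.aestronglyMeasurable (by fun_prop))
    (Continuous.intervalIntegrable (by fun_prop) _ _)
    (Continuous.aestronglyMeasurable (by fun_prop))
    (Filter.Eventually.of_forall fun x hx y _ => ?_)
    intervalIntegrable_const
    (Filter.Eventually.of_forall fun x _ y _ => ?_)).2
  · rw [intervalIntegral.integral_const_mul] at h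
    exact h
  · rw [Set.uIoc_of_le (by norm_num)] at hx
    have he : ‖Complex.exp (Complex.I * y * x)‖ = 1 := by
      simp [Complex.norm_exp]
    rw [norm_mul, norm_mul, he, norm_pow, Complex.norm_I, Complex.norm_real, one_mul, mul_one]
    exact pow_le_one₀ (norm_nonneg _) (abs_le.mpr ⟨hx.1.le, hx.2⟩)
  · have h1 := (hasDerivAt_expWeight x y).const_mul ((x : ℂ) ^ n)
    have hc : ∀ z : ℝ, Complex.I * x * z = Complex.I * z * x := fun z => mul_right_comm _ _ _
    simp only [expWeight, hc] at h1
    exact h1.congr_deriv (by ring)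

lemma hasDerivAt_moment_polyOfCoeffs {m : ℕ} (v : Fin m → ℂ) (j : ℕ) (ω : ℝ) :
    HasDerivAt (fun ω => moment ω (ofPolynomial (polyOfCoeffs v)) j)
      (Complex.I * moment ω (ofPolynomial (polyOfCoeffs v)) (j + 1)) ω := by
  simp only [moment_polyOfCoeffs, Finset.mul_sum]
  refine HasDerivAt.fun_sum fun k _ => ?_
  refine ((hasDerivAt_mu (j + k) ω).mul_const (v k)).congr_deriv ?_
  rw [mul_assoc, add_right_comm]

lemma Differentiable.matrix_det {ι : Type*} [Fintype ι] [DecidableEq ι] {A : ℝ → Matrix ι ι ℂ}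
    (hA : ∀ i j, Differentiable ℝ fun t => A t i j) : Differentiable ℝ fun t => (A t).det := by
  simp only [Matrix.det_apply]
  fun_prop

lemma differentiable_adjugate_hankelMatrix {m : ℕ} (i j : Fin m) :
    Differentiable ℝ fun ω => (hankelMatrix m ω).adjugate i j := by
  simp only [Matrix.adjugate_apply]
  refine Differentiable.matrix_det fun a b => ?_
  by_cases h : a = j
  · simp [h]
  · simp only [Matrix.updateRow_ne h]
    exact fun ω => (hasDerivAt_mu (a + b) ω).differentiableAt

lemma adjugate_hankelMatrix_last (m : ℕ) (ω : ℝ) :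
    (hankelMatrix (m + 1) ω).adjugate (Fin.last m) (Fin.last m) = (hankelMatrix m ω).det := by
  rw [Matrix.adjugate_fin_succ_eq_det_submatrix, ← two_mul, pow_mul, neg_one_sq, one_pow, one_mul]
  congr 1
  ext i j
  simp [hankelMatrix]

lemma differentiable_hankel (n : ℕ) : Differentiable ℝ (hankel n) :=
  Differentiable.matrix_det fun a b ω => (hasDerivAt_mu (a + b) ω).differentiableAt

lemma hankel_mul_last (n : ℕ) (ω : ℝ) (v : Fin (n + 1) → ℂ) :
    hankel n ω * v (Fin.last n) = ∑ j, (hankelMatrix (n + 1) ω).adjugate (Fin.last n) j *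
      moment ω (ofPolynomial (polyOfCoeffs v)) j := by
  have h := congrFun (congrArg (fun M => M.mulVec v) (Matrix.adjugate_mul (hankelMatrix (n + 1) ω)))
    (Fin.last n)
  simp only [← Matrix.mulVec_mulVec, Matrix.smul_mulVec, Matrix.one_mulVec, Pi.smul_apply,
    smul_eq_mul] at h
  rw [show hankel n ω = (hankelMatrix (n + 1) ω).det from rfl, ← h]
  simp only [← hankelMatrix_mulVec]
  rfl

/-- At a zero, the derivative of the Hankel determinant is governed by the first nontrivial moment
of the corresponding degenerate orthogonal polynomial. -/
lemma deriv_hankel_mul_last (n : ℕ) (ω : ℝ) (v : Fin (n + 1) → ℂ)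
    (hv : ∀ j ≤ n, moment ω (ofPolynomial (polyOfCoeffs v)) j = 0) :
    deriv (hankel n) ω * v (Fin.last n) = (hankelMatrix n ω).det *
      (Complex.I * moment ω (ofPolynomial (polyOfCoeffs v)) (n + 1)) := by
  have h1 := ((differentiable_hankel n ω).hasDerivAt.mul_const (v (Fin.last n)))
  simp only [hankel_mul_last] at h1
  have h2 := HasDerivAt.fun_sum (u := Finset.univ) fun (j : Fin (n + 1)) _ =>
    (differentiable_adjugate_hankelMatrix (Fin.last n) j ω).hasDerivAt.mul
      (hasDerivAt_moment_polyOfCoeffs v j ω)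
  rw [h1.unique h2, Fin.sum_univ_castSucc, Finset.sum_eq_zero, adjugate_hankelMatrix_last]
  · simp [hv n le_rfl]
  · intro j _
    simp [hv j j.isLt.le, hv (j + 1) j.isLt]

/-- Every positive real zero of a Hankel determinant is simple. -/
theorem stmt19 :
    ¬ ∃ (n : ℕ) (ω : ℝ), 1 ≤ n ∧ 0 < ω ∧ hankel n ω = 0 ∧ deriv (hankel n) ω = 0 := by
  rintro ⟨n, ω, -, -, h0, h1⟩
  rcases Nat.even_or_odd' n with ⟨N, rfl | rfl⟩
  · obtain ⟨v, hv, hHv⟩ := Matrix.exists_mulVec_eq_zero_iff.mpr h0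
    have hmom : ∀ j ≤ 2 * N, moment ω (ofPolynomial (polyOfCoeffs v)) j = 0 := fun j hj => by
      rw [← hankelMatrix_mulVec (2 * N + 1) ω v ⟨j, by omega⟩]
      exact congrFun hHv _
    have h := deriv_hankel_mul_last (2 * N) ω v hmom
    rw [h1, zero_mul, zero_eq_mul, or_iff_right (det_hankelMatrix_two_mul_ne_zero N ω),
      mul_eq_zero, or_iff_right Complex.I_ne_zero] at h
    refine hv (polyOfCoeffs_eq_zero (polynomial_eq_zero_of_moment_eq_zero ω (N + 1) _
      ((degree_polyOfCoeffs_lt v).trans (by exact_mod_cast (by omega))) fun j hj => ?_))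
    rcases Nat.lt_or_ge (2 * N) j with hlt | hle
    · rwa [show j = 2 * N + 1 by omega]
    · exact hmom j hle
  · exact det_hankelMatrix_two_mul_ne_zero (N + 1) ω h0
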